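/- arXiv:2303.06613 — 5 statements merged into one kernel-verified Lean document; each statement's English description precedes it below -/
import Mathlib

section
/- For every real number ℓ ≥ 1 and every real number a, one has |∫_{1/ℓ}^{1} [sin(πav)/(πv)]·(1 − v)^{ℓ²} dv| ≤ e^{−ℓ}/(πℓ). -/
open Real

theorem one_sub_rpow_le_exp {v s : ℝ} (hv : v ≤ 1) (hs : 0 ≤ s) :
    (1 - v) ^ s ≤ Real.exp (-s * v) := by
  calc (1 - v) ^ s ≤ Real.exp (-v) ^ s :=
        Real.rpow_le_rpow (by linarith) (Real.one_sub_le_exp_neg v) hs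
    _ = Real.exp (-s * v) := by rw [← Real.exp_mul]; ring_nf

theorem integral_exp_neg_mul {s : ℝ} (hs : s ≠ 0) (x y : ℝ) :
    ∫ v in x..y, Real.exp (-s * v) = (Real.exp (-s * x) - Real.exp (-s * y)) / s := by
  rw [intervalIntegral.integral_comp_mul_left (fun v => Real.exp v) (neg_ne_zero.mpr hs),
    integral_exp, smul_eq_mul]
  field_simp
  ring

/-- For every `ℓ ≥ 1` and every real `a`,
`|∫_{1/ℓ}^1 (sin(πav)/(πv)) (1-v)^{ℓ²} dv| ≤ e^{-ℓ}/(πℓ)`. -/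
theorem abs_tail_integral_one_sub_pow_le (ℓ : ℝ) (hℓ : 1 ≤ ℓ) (a : ℝ) :
    |∫ v in (ℓ⁻¹ : ℝ)..1, Real.sin (Real.pi * a * v) / (Real.pi * v) * (1 - v) ^ (ℓ ^ 2)| ≤
      Real.exp (-ℓ) / (Real.pi * ℓ) := by
  have hpos : 0 < ℓ := by linarith
  have hbound : ∀ v ∈ Set.Ioc ℓ⁻¹ 1,
      ‖Real.sin (Real.pi * a * v) / (Real.pi * v) * (1 - v) ^ (ℓ ^ 2)‖ ≤
        ℓ / Real.pi * Real.exp (-(ℓ ^ 2) * v) := by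
    rintro v ⟨hv, hv1⟩
    have hv0 : 0 < v := (inv_pos.mpr hpos).trans hv
    have hpv : 0 < Real.pi * v := by positivity
    rw [norm_mul, norm_div, Real.norm_eq_abs, Real.norm_of_nonneg hpv.le,
      Real.norm_of_nonneg (Real.rpow_nonneg (sub_nonneg.mpr hv1) _)]
    refine mul_le_mul ?_ (one_sub_rpow_le_exp hv1 (sq_nonneg ℓ))
      (Real.rpow_nonneg (sub_nonneg.mpr hv1) _) (by positivity)
    have hlv : 1 ≤ ℓ * v := ((inv_lt_iff_one_lt_mul₀' hpos).mp hv).le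
    rw [div_le_div_iff₀ hpv Real.pi_pos]
    calc |Real.sin (Real.pi * a * v)| * Real.pi ≤ ℓ * v * Real.pi := by
          gcongr
          exact (Real.abs_sin_le_one _).trans hlv
      _ = ℓ * (Real.pi * v) := by ring
  have hmain := intervalIntegral.norm_integral_le_of_norm_le (μ := MeasureTheory.volume)
    (inv_le_one_of_one_le₀ hℓ) (Filter.Eventually.of_forall hbound)
    (Continuous.intervalIntegrable (by fun_prop) _ _)
  rw [intervalIntegral.integral_const_mul, integral_exp_neg_mul (by positivity)] at hmain
  have hexp : -(ℓ ^ 2) * ℓ⁻¹ = -ℓ := by field_simp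
  rw [hexp] at hmain
  calc _ ≤ _ := hmain
    _ ≤ ℓ / Real.pi * (Real.exp (-ℓ) / ℓ ^ 2) := by
        gcongr
        exact sub_le_self _ (Real.exp_pos _).le
    _ = Real.exp (-ℓ) / (Real.pi * ℓ) := by field_simp
end

section
/- For every real number ℓ > 0 and every real number v with 0 ≤ v ≤ 1/2, one has 0 ≤ e^{−ℓ²v} − (1 − v)^{ℓ²} ≤ ℓ²·v²·e^{−ℓ²v}. -/
open Real

/-- A second-order lower bound for the logarithm near `1`. -/
theorem neg_sub_sq_le_log_one_sub {v : ℝ} (hv0 : 0 ≤ v) (hv : v ≤ 1 / 2) :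
    -v - v ^ 2 ≤ Real.log (1 - v) := by
  rw [Real.le_log_iff_exp_le (by linarith), show -v - v ^ 2 = -(v + v ^ 2) by ring, Real.exp_neg]
  refine inv_le_of_inv_le₀ (by linarith) ?_
  refine le_trans ?_ (Real.quadratic_le_exp_of_nonneg (show 0 ≤ v + v ^ 2 by positivity))
  rw [inv_le_iff_one_le_mul₀ (by linarith)]
  have hsq : v ^ 2 ≤ 1 / 4 := by nlinarith
  have hcube : v ^ 3 ≤ 1 / 8 := by nlinarith
  have hpos : 0 ≤ v ^ 2 * (1 - v - v ^ 2 - v ^ 3) := mul_nonneg (sq_nonneg v) (by linarith)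
  linarith

/-- For every `ℓ > 0` and every `v` with `0 ≤ v ≤ 1/2`,
`0 ≤ e^{-ℓ²v} - (1-v)^{ℓ²} ≤ ℓ² v² e^{-ℓ²v}`. -/
theorem exp_sub_one_sub_pow_bounds (ℓ : ℝ) (hℓ : 0 < ℓ) (v : ℝ) (hv0 : 0 ≤ v)
    (hv : v ≤ 1 / 2) :
    0 ≤ Real.exp (-(ℓ ^ 2 * v)) - (1 - v) ^ (ℓ ^ 2) ∧
      Real.exp (-(ℓ ^ 2 * v)) - (1 - v) ^ (ℓ ^ 2) ≤ ℓ ^ 2 * v ^ 2 * Real.exp (-(ℓ ^ 2 * v)) := by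
  have hlog_le : Real.log (1 - v) ≤ -v := by
    linarith [Real.log_le_sub_one_of_pos (show 0 < 1 - v by linarith)]
  have hle_log := neg_sub_sq_le_log_one_sub hv0 hv
  have hsq : 0 ≤ ℓ ^ 2 := sq_nonneg ℓ
  rw [Real.rpow_def_of_pos (by linarith : 0 < 1 - v)]
  constructor
  · rw [sub_nonneg, Real.exp_le_exp]
    linarith [mul_le_mul_of_nonneg_left hlog_le hsq]
  · have hexp : Real.exp (-(ℓ ^ 2 * v)) * Real.exp (-(ℓ ^ 2 * v ^ 2)) ≤
        Real.exp (Real.log (1 - v) * ℓ ^ 2) := by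
      rw [← Real.exp_add, Real.exp_le_exp]
      linarith [mul_le_mul_of_nonneg_left hle_log hsq]
    have hlin := mul_le_mul_of_nonneg_left (Real.add_one_le_exp (-(ℓ ^ 2 * v ^ 2)))
      (Real.exp_pos (-(ℓ ^ 2 * v))).le
    linarith
end

section
/- For every real number ℓ ≥ 2 and every real number a > 0, one has |∫₀^{1/ℓ} [sin(πav)/(πv)]·(e^{−ℓ²v} − (1 − v)^{ℓ²}) dv| ≤ 2a/ℓ⁴. -/
open Real

lemma one_sub_rpow_le_exp_neg_mul {v N : ℝ} (hv : v ≤ 1) (hN : 0 ≤ N) :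
    (1 - v) ^ N ≤ Real.exp (-(N * v)) := by
  calc (1 - v) ^ N ≤ (Real.exp (-v)) ^ N :=
        Real.rpow_le_rpow (by linarith) (Real.one_sub_le_exp_neg v) hN
    _ = Real.exp (-(N * v)) := by
        rw [← Real.exp_mul]
        congr 1
        ring

lemma continuous_exp_neg_mul_sub_one_sub_rpow {N : ℝ} (hN : 0 ≤ N) :
    Continuous fun v : ℝ => Real.exp (-(N * v)) - (1 - v) ^ N := by
  have h : Continuous fun v : ℝ => (1 - v) ^ N :=
    (continuous_const.sub continuous_id).rpow_const fun _ => Or.inr hN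
  fun_prop

lemma integral_exp_neg_mul_sub_one_sub_rpow_le {N b : ℝ} (hN : 0 < N) (hb0 : 0 ≤ b)
    (hb1 : b ≤ 1) :
    ∫ v in (0 : ℝ)..b, (Real.exp (-(N * v)) - (1 - v) ^ N) ≤ 1 / N - 1 / (N + 1) := by
  have hderiv (v : ℝ) : HasDerivAt
      (fun v : ℝ => (1 - v) ^ (N + 1) / (N + 1) - Real.exp (-(N * v)) / N)
      (Real.exp (-(N * v)) - (1 - v) ^ N) v := by
    have h1 := (((hasDerivAt_id v).const_sub 1).rpow_const (p := N + 1)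
      (Or.inr (by linarith))).div_const (N + 1)
    have h2 := (((hasDerivAt_id v).const_mul N).neg.exp).div_const N
    refine (h1.sub h2).congr_deriv ?_
    have : N + 1 ≠ 0 := by positivity
    simp only [id, Pi.neg_apply, add_sub_cancel_right]
    field_simp
    ring
  rw [intervalIntegral.integral_eq_sub_of_hasDerivAt (fun v _ => hderiv v)
    ((continuous_exp_neg_mul_sub_one_sub_rpow hN.le).intervalIntegrable 0 b)]
  have hle : (1 - b) ^ (N + 1) / (N + 1) ≤ Real.exp (-(N * b)) / N := by
    have h1 : (1 - b) ^ (N + 1) ≤ Real.exp (-(N * b)) := by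
      refine (one_sub_rpow_le_exp_neg_mul hb1 (by positivity)).trans ?_
      exact Real.exp_le_exp.mpr (by nlinarith)
    exact div_le_div₀ (Real.exp_pos _).le h1 hN (by linarith)
  simp only [sub_zero, Real.one_rpow, mul_zero, neg_zero, Real.exp_zero]
  linarith

lemma abs_sin_pi_mul_div_le {a v : ℝ} (ha : 0 ≤ a) :
    |Real.sin (Real.pi * a * v) / (Real.pi * v)| ≤ a := by
  rw [abs_div]
  refine div_le_of_le_mul₀ (abs_nonneg _) ha (Real.abs_sin_le_abs.trans_eq ?_)
  rw [mul_right_comm, abs_mul, abs_of_nonneg ha, mul_comm]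

/-- For every `ℓ ≥ 2` and every `a > 0`,
`|∫₀^{1/ℓ} (sin(πav)/(πv)) (e^{-ℓ²v} - (1-v)^{ℓ²}) dv| ≤ 2a/ℓ⁴`. -/
theorem abs_integral_exp_sub_one_sub_pow_le (ℓ : ℝ) (hℓ : 2 ≤ ℓ) (a : ℝ) (ha : 0 < a) :
    |∫ v in (0 : ℝ)..ℓ⁻¹,
        Real.sin (Real.pi * a * v) / (Real.pi * v) *
          (Real.exp (-(ℓ ^ 2 * v)) - (1 - v) ^ (ℓ ^ 2))| ≤
      2 * a / ℓ ^ 4 := by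
  have hpos : 0 < ℓ := by linarith
  have hN : 0 < ℓ ^ 2 := by positivity
  have hb0 : 0 ≤ ℓ⁻¹ := by positivity
  have hb1 : ℓ⁻¹ ≤ 1 := inv_le_one_of_one_le₀ (by linarith)
  have hbound : ∀ v ∈ Set.Ioc 0 ℓ⁻¹,
      ‖Real.sin (Real.pi * a * v) / (Real.pi * v) *
        (Real.exp (-(ℓ ^ 2 * v)) - (1 - v) ^ (ℓ ^ 2))‖ ≤
      a * (Real.exp (-(ℓ ^ 2 * v)) - (1 - v) ^ (ℓ ^ 2)) := by
    intro v hv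
    have hnonneg := sub_nonneg.mpr (one_sub_rpow_le_exp_neg_mul (hv.2.trans hb1) hN.le)
    rw [norm_mul, Real.norm_of_nonneg hnonneg]
    exact mul_le_mul_of_nonneg_right (abs_sin_pi_mul_div_le ha.le) hnonneg
  have hint := ((continuous_exp_neg_mul_sub_one_sub_rpow hN.le).const_mul a).intervalIntegrable
    (μ := MeasureTheory.volume) 0 ℓ⁻¹
  refine (intervalIntegral.norm_integral_le_of_norm_le hb0
    (Filter.Eventually.of_forall hbound) hint).trans ?_
  rw [intervalIntegral.integral_const_mul]
  calc a * ∫ v in (0 : ℝ)..ℓ⁻¹, (Real.exp (-(ℓ ^ 2 * v)) - (1 - v) ^ (ℓ ^ 2))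
      ≤ a * (1 / ℓ ^ 2 - 1 / (ℓ ^ 2 + 1)) :=
        mul_le_mul_of_nonneg_left (integral_exp_neg_mul_sub_one_sub_rpow_le hN hb0 hb1) ha.le
    _ = a / (ℓ ^ 2 * (ℓ ^ 2 + 1)) := by
        field_simp
        ring
    _ ≤ 2 * a / ℓ ^ 4 := by
        refine div_le_div₀ (by positivity) (by linarith) (by positivity) ?_
        nlinarith
end

section
/- Let r ≥ 8 be an integer, let θ ∈ [−1, 1], and set ℓ := B₀·√(r + θ√r), where B₀ is as defined in the context. Then (2ℓ/√r)·∫₀¹ [sin(π(r + θ√r)v)/(πv)]·(1 − v)^{ℓ²} dv ≥ A₀ + (1/√r)·{ θ·A₀/(√(1 + θ/√r) + 1) − 4·( e^{−B₀√(r + θ√r)}/π + 1/(B₀³·√(r + θ√r)) ) }. -/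
open Real

open MeasureTheory Set in
/-- The Laplace transform of the cosine. -/
theorem integral_cos_mul_exp_neg_mul_Ioi {n : ℝ} (hn : 0 < n) (a : ℝ) :
    ∫ v in Ioi (0 : ℝ), cos (a * v) * exp (-(n * v)) = n / (n ^ 2 + a ^ 2) := by
  have hre : ((-n : ℂ) + a * Complex.I).re < 0 := by simpa using hn
  have hint := integrableOn_exp_mul_complex_Ioi hre 0
  have h := congrArg Complex.re (integral_exp_mul_complex_Ioi hre 0)
  have h2 := integral_re (𝕜 := ℂ) hint
  simp only [RCLike.re_to_complex] at h2
  rw [← h2] at h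
  convert h using 1
  · refine integral_congr_ae (Filter.Eventually.of_forall fun v => ?_)
    simp [Complex.exp_re, mul_comm]
  · simp [Complex.div_re, Complex.normSq_apply, sq]

theorem abs_sin_mul_div_le (a v : ℝ) : |sin (a * v) / v| ≤ |a| := by
  rw [abs_div]
  refine div_le_of_le_mul₀ (abs_nonneg v) (abs_nonneg a) ?_
  rw [← abs_mul]
  exact abs_sin_le_abs

open MeasureTheory Set in
theorem integrableOn_exp_neg_mul_Ioi {n : ℝ} (hn : 0 < n) :
    IntegrableOn (fun v : ℝ => exp (-(n * v))) (Ioi 0) := by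
  simpa using integrableOn_exp_mul_Ioi (neg_lt_zero.2 hn) 0

open MeasureTheory Set in
theorem integrableOn_sin_mul_div_mul_exp_neg_mul {n : ℝ} (hn : 0 < n) (a : ℝ) :
    IntegrableOn (fun v : ℝ => sin (a * v) / v * exp (-(n * v))) (Ioi 0) := by
  refine ((integrableOn_exp_neg_mul_Ioi hn).const_mul |a|).mono'
    (by fun_prop : Measurable _).aestronglyMeasurable (Filter.Eventually.of_forall fun v => ?_)
  rw [norm_mul, norm_eq_abs, norm_of_nonneg (exp_pos _).le]
  exact mul_le_mul_of_nonneg_right (abs_sin_mul_div_le a v) (exp_pos _).le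

open MeasureTheory Set in
/-- The Laplace transform of `sin (a v) / v`. -/
theorem integral_sin_mul_div_mul_exp_neg_mul_Ioi {n : ℝ} (hn : 0 < n) (a : ℝ) :
    ∫ v in Ioi (0 : ℝ), sin (a * v) / v * exp (-(n * v)) = arctan (a / n) := by
  have hderiv (x : ℝ) : HasDerivAt
      (fun x : ℝ => ∫ v in Ioi (0 : ℝ), sin (x * v) / v * exp (-(n * v)))
      (n / (n ^ 2 + x ^ 2)) x := by
    rw [← integral_cos_mul_exp_neg_mul_Ioi hn x]
    refine (hasDerivAt_integral_of_dominated_loc_of_deriv_le (s := univ) Filter.univ_mem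
      (Filter.Eventually.of_forall fun y =>
        (by fun_prop : Measurable fun v : ℝ =>
          sin (y * v) / v * exp (-(n * v))).aestronglyMeasurable)
      (integrableOn_sin_mul_div_mul_exp_neg_mul hn x)
      (F' := fun y v => cos (y * v) * exp (-(n * v)))
      (by fun_prop : Measurable _).aestronglyMeasurable
      (Filter.Eventually.of_forall fun v y _ => ?_)
      (integrableOn_exp_neg_mul_Ioi hn) ?_).2
    · rw [norm_mul, norm_eq_abs, norm_of_nonneg (exp_pos _).le]
      exact mul_le_of_le_one_left (exp_pos _).le (abs_cos_le_one _)
    · refine (ae_restrict_iff' measurableSet_Ioi).2 (Filter.Eventually.of_forall fun v hv y _ => ?_)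
      have hv0 : v ≠ 0 := (mem_Ioi.1 hv).ne'
      have h := ((((hasDerivAt_id y).mul_const v).sin).div_const v).mul_const (exp (-(n * v)))
      convert! h using 1
      simp [hv0]
  have hdiff (x : ℝ) : HasDerivAt (fun x : ℝ =>
      (∫ v in Ioi (0 : ℝ), sin (x * v) / v * exp (-(n * v))) - arctan (x / n)) 0 x := by
    convert! (hderiv x).sub ((hasDerivAt_id x).div_const n).arctan using 1
    have : 0 < n ^ 2 + x ^ 2 := by positivity
    simp only [id]
    field_simp
    ring
  have hconst := is_const_of_deriv_eq_zero (fun x => (hdiff x).differentiableAt)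
    (fun x => (hdiff x).deriv) a 0
  simpa [sub_eq_zero] using hconst

/-- A quadratic bound for the error of approximating `e^{-nv}` by `(1 - v)^n`, extended by zero
past `v = 1`. -/
theorem exp_neg_mul_sub_max_rpow_le {n v : ℝ} (hn : 1 ≤ n) (hv : 0 ≤ v) :
    exp (-(n * v)) - max (1 - v) 0 ^ n ≤ n * v ^ 2 * exp (-(n * v)) := by
  rcases le_total v 1 with h | h
  · have h1 : 0 ≤ 1 - v := sub_nonneg.2 h
    rw [max_eq_left h1]
    have h2 : 1 + n * (-v ^ 2) ≤ (1 + -v ^ 2) ^ n :=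
      one_add_mul_self_le_rpow_one_add (by nlinarith) hn
    have h3 : (1 + -v ^ 2) ^ n ≤ ((1 - v) * exp v) ^ n := by
      refine rpow_le_rpow (by nlinarith) ?_ (by linarith)
      nlinarith [add_one_le_exp v]
    rw [mul_rpow h1 (exp_pos _).le, ← exp_mul] at h3
    have h4 := mul_le_mul_of_nonneg_right (h2.trans h3) (exp_pos (-(n * v))).le
    rw [mul_assoc, ← exp_add, show v * n + -(n * v) = 0 by ring, exp_zero] at h4
    linarith
  · rw [max_eq_right (by linarith), zero_rpow (by linarith), sub_zero]
    exact le_mul_of_one_le_left (exp_pos _).le (by nlinarith)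

theorem max_rpow_le_exp_neg_mul {n : ℝ} (hn : 0 < n) (v : ℝ) :
    max (1 - v) 0 ^ n ≤ exp (-(n * v)) := by
  rw [show -(n * v) = -v * n by ring, exp_mul]
  exact rpow_le_rpow (le_max_right _ _)
    (max_le (one_sub_le_exp_neg v) (exp_pos _).le) hn.le

open MeasureTheory Set in
theorem arctan_div_sub_inv_le_integral {n : ℝ} (hn : 1 ≤ n) (a : ℝ) :
    arctan (a / n) - 1 / n ≤ ∫ v in (0 : ℝ)..1, sin (a * v) / v * (1 - v) ^ n := by
  have hn0 : 0 < n := by linarith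
  have hext : ∫ v in (0 : ℝ)..1, sin (a * v) / v * (1 - v) ^ n =
      ∫ v in Ioi (0 : ℝ), sin (a * v) / v * max (1 - v) 0 ^ n := by
    rw [intervalIntegral.integral_of_le zero_le_one]
    rw [setIntegral_eq_of_subset_of_forall_sdiff_eq_zero
      (f := fun v : ℝ => sin (a * v) / v * max (1 - v) 0 ^ n) measurableSet_Ioi
      (Ioc_subset_Ioi_self : Ioc (0 : ℝ) 1 ⊆ Ioi 0)]
    · refine setIntegral_congr_fun measurableSet_Ioc fun v hv => ?_
      rw [max_eq_left (by linarith [hv.2])]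
    · intro v hv
      have hv1 : 1 < v := by
        by_contra! h
        exact hv.2 ⟨hv.1, h⟩
      rw [max_eq_right (by linarith), zero_rpow hn0.ne', mul_zero]
  have hint : IntegrableOn (fun v : ℝ => sin (a * v) / v * max (1 - v) 0 ^ n) (Ioi 0) := by
    refine ((integrableOn_exp_neg_mul_Ioi hn0).const_mul |a|).mono'
      (by fun_prop : Measurable _).aestronglyMeasurable (Filter.Eventually.of_forall fun v => ?_)
    rw [norm_mul, norm_eq_abs, norm_of_nonneg (rpow_nonneg (le_max_right _ _) n)]
    exact mul_le_mul (abs_sin_mul_div_le a v) (max_rpow_le_exp_neg_mul hn0 v)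
      (rpow_nonneg (le_max_right _ _) n) (abs_nonneg a)
  have hlin : ∫ v in Ioi (0 : ℝ), n * (v * exp (-(n * v))) = 1 / n := by
    have h := integral_rpow_mul_exp_neg_mul_Ioi (a := 2) two_pos hn0
    norm_num at h
    rw [integral_const_mul, h]
    field_simp
  have hlinint : IntegrableOn (fun v : ℝ => n * (v * exp (-(n * v)))) (Ioi 0) := by
    refine Integrable.of_integral_ne_zero ?_
    rw [hlin]
    positivity
  rw [hext, ← integral_sin_mul_div_mul_exp_neg_mul_Ioi hn0 a, ← hlin, sub_le_comm,
    ← integral_sub (integrableOn_sin_mul_div_mul_exp_neg_mul hn0 a) hint]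
  refine setIntegral_mono_on
    ((integrableOn_sin_mul_div_mul_exp_neg_mul hn0 a).sub hint) hlinint
    measurableSet_Ioi fun v hv => ?_
  have hv0 : 0 < v := hv
  have h1 := exp_neg_mul_sub_max_rpow_le hn hv0.le
  have h2 := sub_nonneg.2 (max_rpow_le_exp_neg_mul hn0 v)
  calc sin (a * v) / v * exp (-(n * v)) - sin (a * v) / v * max (1 - v) 0 ^ n
      = sin (a * v) * ((exp (-(n * v)) - max (1 - v) 0 ^ n) / v) := by ring
    _ ≤ (exp (-(n * v)) - max (1 - v) 0 ^ n) / v :=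
        mul_le_of_le_one_left (div_nonneg h2 hv0.le) (sin_le_one _)
    _ ≤ n * (v * exp (-(n * v))) := by
        rw [div_le_iff₀ hv0]
        linarith

theorem arctan_le_self_of_nonneg {x : ℝ} (hx : 0 ≤ x) : arctan x ≤ x := by
  simpa using le_tan (arctan_nonneg.2 hx) (arctan_lt_pi_div_two x)

/-- Coarse bounds on a maximizer of `B ↦ B * arctan (π / B ^ 2)`, obtained by comparing with the
value at `√π`. -/
theorem sq_bounds_of_forall_mul_arctan_le {B₀ : ℝ} (hB₀ : 0 < B₀)
    (hmax : ∀ B : ℝ, 0 < B → B * arctan (π / B ^ 2) ≤ B₀ * arctan (π / B₀ ^ 2)) :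
    π / 4 ≤ B₀ ^ 2 ∧ B₀ ^ 2 ≤ 2 * π := by
  have hs : 0 < √π := sqrt_pos.2 pi_pos
  have hss : √π ^ 2 = π := sq_sqrt pi_pos.le
  have h := hmax _ hs
  rw [hss, div_self pi_ne_zero, arctan_one] at h
  have hlow : √π / 2 ≤ B₀ := by
    have := mul_le_mul_of_nonneg_left (arctan_lt_pi_div_two (π / B₀ ^ 2)).le hB₀.le
    nlinarith [pi_pos]
  have hup : B₀ * √π ≤ 4 := by
    have h1 := mul_le_mul_of_nonneg_left
      (arctan_le_self_of_nonneg (x := π / B₀ ^ 2) (by positivity)) hB₀.le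
    have h2 : B₀ * (π / B₀ ^ 2) = π / B₀ := by field_simp
    have h3 := h.trans (h1.trans_eq h2)
    rw [le_div_iff₀ hB₀] at h3
    nlinarith [pi_pos]
  constructor
  · nlinarith
  · have h1 : B₀ ^ 2 * π ≤ 16 := by
      rw [← hss, ← mul_pow]
      nlinarith [mul_pos hB₀ hs]
    nlinarith [pi_gt_three]


/-- Let `B₀` be the unique maximum point on `(0,∞)` of `B ↦ B · arctan(π/B²)` and
`A₀ = (2B₀/π) arctan(π/B₀²)`. For an integer `r ≥ 8`, `θ ∈ [-1,1]` and
`ℓ = B₀ √(r + θ√r)`, one has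
`(2ℓ/√r) ∫₀¹ (sin(π(r + θ√r)v)/(πv)) (1-v)^{ℓ²} dv ≥
  A₀ + (1/√r)(θ A₀/(√(1 + θ/√r) + 1) - 4(e^{-B₀√(r+θ√r)}/π + 1/(B₀³√(r+θ√r))))`. -/
theorem saddle_point_lower_bound (B₀ A₀ : ℝ) (hB₀pos : 0 < B₀)
    (hB₀max : ∀ B : ℝ, 0 < B →
      B * Real.arctan (Real.pi / B ^ 2) ≤ B₀ * Real.arctan (Real.pi / B₀ ^ 2))
    (hB₀uniq : ∀ B : ℝ, 0 < B →
      B * Real.arctan (Real.pi / B ^ 2) = B₀ * Real.arctan (Real.pi / B₀ ^ 2) → B = B₀)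
    (hA₀ : A₀ = 2 * B₀ / Real.pi * Real.arctan (Real.pi / B₀ ^ 2))
    (r : ℕ) (hr : 8 ≤ r) (θ : ℝ) (hθ : θ ∈ Set.Icc (-1 : ℝ) 1)
    (ℓ : ℝ) (hℓ : ℓ = B₀ * Real.sqrt ((r : ℝ) + θ * Real.sqrt r)) :
    A₀ + (1 / Real.sqrt r) *
        (θ * A₀ / (Real.sqrt (1 + θ / Real.sqrt r) + 1) -
          4 * (Real.exp (-(B₀ * Real.sqrt ((r : ℝ) + θ * Real.sqrt r))) / Real.pi +
            1 / (B₀ ^ 3 * Real.sqrt ((r : ℝ) + θ * Real.sqrt r)))) ≤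
      2 * ℓ / Real.sqrt r *
        ∫ v in (0 : ℝ)..1,
          Real.sin (Real.pi * ((r : ℝ) + θ * Real.sqrt r) * v) / (Real.pi * v) *
            (1 - v) ^ (ℓ ^ 2) := by
  obtain ⟨hBlow, hBup⟩ := sq_bounds_of_forall_mul_arctan_le hB₀pos hB₀max
  have hr8 : (8 : ℝ) ≤ r := by exact_mod_cast hr
  set s := √(r : ℝ) with hs
  have hs0 : 0 < s := sqrt_pos.2 (by linarith)
  have hss : s ^ 2 = r := sq_sqrt (by linarith)
  set R : ℝ := r + θ * s with hR
  have hR2 : 2 ≤ R := by nlinarith [hθ.1]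
  set t := √R with ht
  have ht0 : 0 < t := sqrt_pos.2 (by linarith)
  have htt : t ^ 2 = R := sq_sqrt (by linarith)
  have hratio : √(1 + θ / s) = t / s := by
    rw [ht, hs, ← sqrt_div (by linarith)]
    have h : θ / s * r = θ * s := by
      rw [div_mul_eq_mul_div, div_eq_iff hs0.ne', mul_assoc, ← sq, hss]
    congr 1
    rw [eq_div_iff (by linarith)]
    linear_combination h
  have hmain : θ * A₀ / (t / s + 1) = A₀ * (t - s) := by
    have : θ * s = t ^ 2 - s ^ 2 := by rw [htt, hss, hR]; ring
    have hsum : t / s + 1 ≠ 0 := by positivity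
    rw [div_eq_iff hsum]
    field_simp
    linear_combination A₀ * this
  have hn : ℓ ^ 2 = B₀ ^ 2 * R := by rw [hℓ, mul_pow, htt]
  have hn1 : 1 ≤ ℓ ^ 2 := by rw [hn]; nlinarith [pi_gt_three]
  have hint := arctan_div_sub_inv_le_integral hn1 (π * R)
  have harg : π * R / ℓ ^ 2 = π / B₀ ^ 2 := by
    rw [hn]
    field_simp
  have hpull : ∫ v in (0 : ℝ)..1, sin (π * R * v) / (π * v) * (1 - v) ^ (ℓ ^ 2) =
      (∫ v in (0 : ℝ)..1, sin (π * R * v) / v * (1 - v) ^ (ℓ ^ 2)) / π := by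
    rw [← intervalIntegral.integral_div]
    congr 1 with v
    rw [mul_comm π v, ← div_div]
    ring
  rw [harg, hn, ← htt] at hint
  rw [hpull, hratio, hmain, hn, ← htt, hℓ, hA₀]
  set T := arctan (π / B₀ ^ 2)
  have hlower : 2 * (B₀ * t) / s * ((T - 1 / (B₀ ^ 2 * t ^ 2)) / π) ≤
      2 * (B₀ * t) / s * ((∫ v in (0 : ℝ)..1,
        sin (π * t ^ 2 * v) / v * (1 - v) ^ (B₀ ^ 2 * t ^ 2)) / π) := by
    gcongr
  refine le_trans ?_ hlower
  have herr : 2 / (B₀ * t * π) ≤ 4 * (exp (-(B₀ * t)) / π + 1 / (B₀ ^ 3 * t)) := by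
    have h1 : 0 < exp (-(B₀ * t)) / π := by positivity
    have h2 : 2 / (B₀ * t * π) ≤ 4 * (1 / (B₀ ^ 3 * t)) := by
      rw [mul_one_div, div_le_div_iff₀ (by positivity) (by positivity)]
      have := mul_le_mul_of_nonneg_left hBup (mul_pos hB₀pos ht0).le
      nlinarith [mul_pos hB₀pos ht0]
    linarith
  have herr' := mul_le_mul_of_nonneg_left herr (one_div_pos.2 hs0).le
  have heq : 2 * (B₀ * t) / s * ((T - 1 / (B₀ ^ 2 * t ^ 2)) / π) =
      2 * B₀ / π * T + 1 / s * (2 * B₀ / π * T * (t - s)) - 1 / s * (2 / (B₀ * t * π)) := by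
    field_simp
    ring
  rw [heq, mul_sub]
  linarith
end

section
/- With Θ = A₀, for every real number r ≥ 8 one has Θ·A₀/(√(1 + Θ/√r) + 1) − 4·( e^{−B₀√(r + Θ√r)}/π + 1/(B₀³·√(r + Θ√r)) ) ≥ 0.009; in particular this quantity is positive, and it is monotonically increasing as a function of r for r ≥ 1. -/
open Real

/-- The cubic Taylor polynomial of `arctan` is a lower bound on `[0, ∞)`. -/
theorem sub_cube_div_three_le_arctan {x : ℝ} (hx : 0 ≤ x) : x - x ^ 3 / 3 ≤ arctan x := by
  have hd (y : ℝ) : HasDerivAt (fun y : ℝ => arctan y - (y - y ^ 3 / 3))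
      (1 / (1 + y ^ 2) - (1 - y ^ 2)) y := by
    refine ((hasDerivAt_arctan y).sub
      ((hasDerivAt_id y).sub (((hasDerivAt_id y).pow 3).div_const 3))).congr_deriv ?_
    simp
  have hmono : Monotone (fun y : ℝ => arctan y - (y - y ^ 3 / 3)) := by
    refine monotone_of_deriv_nonneg (fun y => (hd y).differentiableAt) fun y => ?_
    rw [(hd y).deriv, sub_nonneg, le_div_iff₀ (by positivity)]
    nlinarith [sq_nonneg (y ^ 2)]
  have h := hmono hx
  simp only [arctan_zero] at h
  linarith

theorem arctan_eq_pi_div_four_add {x : ℝ} (hx : 0 < x) :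
    arctan x = π / 4 + arctan ((x - 1) / (x + 1)) := by
  have hx1 : 0 < x + 1 := by linarith
  have hlt : 1 * ((x - 1) / (x + 1)) < 1 := by
    rw [one_mul, div_lt_one hx1]
    linarith
  rw [← arctan_one, arctan_add hlt]
  congr 1
  field_simp
  ring

theorem pi_div_four_add_le_arctan {x : ℝ} (hx : 1 ≤ x) :
    π / 4 + ((x - 1) / (x + 1) - ((x - 1) / (x + 1)) ^ 3 / 3) ≤ arctan x := by
  rw [arctan_eq_pi_div_four_add (by linarith)]
  gcongr
  exact sub_cube_div_three_le_arctan (div_nonneg (by linarith) (by linarith))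

theorem hasDerivAt_mul_arctan_pi_div_sq {B : ℝ} (hB : B ≠ 0) :
    HasDerivAt (fun B : ℝ => B * arctan (π / B ^ 2))
      (arctan (π / B ^ 2) - 2 * (π / B ^ 2) / (1 + (π / B ^ 2) ^ 2)) B := by
  have h1 : HasDerivAt (fun B : ℝ => π / B ^ 2) (-(2 * π) / B ^ 3) B := by
    refine ((hasDerivAt_const B π).div ((hasDerivAt_id B).pow 2)
      (pow_ne_zero 2 hB)).congr_deriv ?_
    simp
    field_simp
  refine ((hasDerivAt_id B).mul h1.arctan).congr_deriv ?_
  simp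
  field_simp
  ring

theorem two_mul_div_one_add_sq_lt_arctan {u : ℝ} (hu : 1.3925 ≤ u) :
    2 * u / (1 + u ^ 2) < arctan u := by
  have hd (y : ℝ) : HasDerivAt (fun y : ℝ => arctan y - 2 * y / (1 + y ^ 2))
      ((3 * y ^ 2 - 1) / (1 + y ^ 2) ^ 2) y := by
    have hy : 1 + y ^ 2 ≠ 0 := by positivity
    refine ((hasDerivAt_arctan y).sub (((hasDerivAt_id y).const_mul 2).div
      (((hasDerivAt_id y).pow 2).const_add 1) hy)).congr_deriv ?_
    simp
    field_simp
    ring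
  have hmono : MonotoneOn (fun y : ℝ => arctan y - 2 * y / (1 + y ^ 2)) (Set.Ici 1) := by
    refine monotoneOn_of_deriv_nonneg (convex_Ici 1)
      (fun y _ => (hd y).continuousAt.continuousWithinAt)
      (fun y _ => (hd y).differentiableAt.differentiableWithinAt) fun y hy => ?_
    rw [interior_Ici, Set.mem_Ioi] at hy
    rw [(hd y).deriv]
    have : 0 ≤ 3 * y ^ 2 - 1 := by nlinarith
    positivity
  have h := hmono (Set.mem_Ici.2 (by norm_num)) (Set.mem_Ici.2 (by linarith)) hu
  have h2 := pi_div_four_add_le_arctan (x := 1.3925) (by norm_num)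
  have h3 := pi_gt_d6
  norm_num at h h2 h3 ⊢
  linarith

/-- A maximum point of `B ↦ B * arctan (π / B ^ 2)` is at least `1.502`. -/
theorem le_argmax_mul_arctan_pi_div_sq {B₀ : ℝ} (hpos : 0 < B₀)
    (hmax : ∀ B : ℝ, 0 < B → B * arctan (π / B ^ 2) ≤ B₀ * arctan (π / B₀ ^ 2)) :
    1.502 ≤ B₀ := by
  by_contra! hlt
  have hloc : IsLocalMax (fun B : ℝ => B * arctan (π / B ^ 2)) B₀ := by
    filter_upwards [lt_mem_nhds hpos] with B hB using hmax B hB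
  have hzero := hloc.hasDerivAt_eq_zero (hasDerivAt_mul_arctan_pi_div_sq hpos.ne')
  have hu : 1.3925 ≤ π / B₀ ^ 2 := by
    rw [le_div_iff₀ (by positivity)]
    nlinarith [pi_gt_d6]
  linarith [two_mul_div_one_add_sq_lt_arctan hu]

/-- The maximum of `B ↦ (2 * B / π) * arctan (π / B ^ 2)` is at least `0.9064`. -/
theorem le_max_mul_arctan_pi_div_sq {B₀ : ℝ}
    (hmax : ∀ B : ℝ, 0 < B → B * arctan (π / B ^ 2) ≤ B₀ * arctan (π / B₀ ^ 2)) :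
    0.9064 ≤ 2 * B₀ / π * arctan (π / B₀ ^ 2) := by
  have h := hmax 1.5 (by norm_num)
  have hu : (1.39626 : ℝ) ≤ π / 1.5 ^ 2 := by
    rw [le_div_iff₀ (by positivity)]
    linarith [pi_gt_d6]
  have h2 := (pi_div_four_add_le_arctan (x := 1.39626) (by norm_num)).trans (arctan_mono hu)
  have h3 := pi_lt_d6
  have h4 : 2 * B₀ / π * arctan (π / B₀ ^ 2) = 2 * (B₀ * arctan (π / B₀ ^ 2)) / π := by ring
  rw [h4, le_div_iff₀ pi_pos]
  norm_num at h h2 h3 ⊢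
  linarith

theorem sq_div_sqrt_one_add_div_add_one_le {a A q : ℝ} (ha : 0 < a) (hA : a ≤ A) (hq : 0 < q) :
    a ^ 2 / (√(1 + a / q) + 1) ≤ A ^ 2 / (√(1 + A / q) + 1) := by
  have hA0 : 0 < A := ha.trans_le hA
  have hs : a * √(1 + A / q) ≤ A * √(1 + a / q) := by
    rw [← abs_of_pos ha, ← abs_of_pos hA0, ← sqrt_sq_eq_abs, ← sqrt_sq_eq_abs,
      ← sqrt_mul (by positivity), ← sqrt_mul (by positivity), sqrt_sq ha.le, sqrt_sq hA0.le]
    apply sqrt_le_sqrt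
    have h1 : a ^ 2 * (1 + A / q) = a ^ 2 + a * (a * A / q) := by ring
    have h2 : A ^ 2 * (1 + a / q) = A ^ 2 + A * (a * A / q) := by ring
    rw [h1, h2]
    gcongr
  rw [div_le_div_iff₀ (by positivity) (by positivity)]
  have h3 : a * (√(1 + A / q) + 1) ≤ A * (√(1 + a / q) + 1) := by linarith
  calc a ^ 2 * (√(1 + A / q) + 1) = a * (a * (√(1 + A / q) + 1)) := by ring
    _ ≤ A * (A * (√(1 + a / q) + 1)) := by gcongr
    _ = A ^ 2 * (√(1 + a / q) + 1) := by ring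

theorem exp_neg_le_of_ge {x : ℝ} (hx : 4.88 ≤ x) : exp (-x) ≤ 0.00767 := by
  have h1 : exp (-x) ≤ exp 0.12 * exp (-5) := by
    rw [← exp_add]
    gcongr
    linarith
  have h2 : exp 0.12 ≤ 1 / 0.88 := by
    have h := one_sub_le_exp_neg (0.12 : ℝ)
    rw [exp_neg] at h
    rw [le_div_iff₀ (by norm_num)]
    have := mul_le_mul_of_nonneg_left h (exp_pos 0.12).le
    rw [mul_inv_cancel₀ (exp_pos _).ne'] at this
    linarith
  have h3 : exp (-5) ≤ 1 / 2.718 ^ 5 := by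
    have h5 : exp 5 = exp 1 ^ 5 := by rw [← exp_nat_mul]; norm_num
    rw [exp_neg, ← one_div, h5]
    gcongr
    linarith [exp_one_gt_d9]
  calc exp (-x) ≤ exp 0.12 * exp (-5) := h1
    _ ≤ 1 / 0.88 * (1 / 2.718 ^ 5) := by gcongr
    _ ≤ 0.00767 := by norm_num

theorem bracket_lower_bound {A B r : ℝ} (hA : 0.9064 ≤ A) (hB : 1.502 ≤ B) (hr : 8 ≤ r) :
    0.009 ≤ A * A / (√(1 + A / √r) + 1) -
      4 * (exp (-(B * √(r + A * √r))) / π + 1 / (B ^ 3 * √(r + A * √r))) := by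
  have hq : 2.8284 ≤ √r := le_sqrt_of_sq_le (by norm_num; linarith)
  have hR : 3.2501 ≤ √(r + A * √r) := le_sqrt_of_sq_le (by norm_num at *; nlinarith)
  have hs : √(1 + 0.9064 / √r) ≤ 1.14915 := by
    rw [sqrt_le_left (by norm_num)]
    have h : 0.9064 / √r ≤ 0.9064 / 2.8284 := by gcongr
    norm_num at h ⊢
    linarith
  have hmain : 0.38226 ≤ A * A / (√(1 + A / √r) + 1) := by
    rw [← sq]
    refine le_trans ?_
      (sq_div_sqrt_one_add_div_add_one_le (by norm_num) hA (by linarith : 0 < √r))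
    rw [le_div_iff₀ (by positivity)]
    norm_num at hs ⊢
    linarith
  have hexp : exp (-(B * √(r + A * √r))) / π ≤ 0.00767 / 3.1415 := by
    gcongr
    · refine exp_neg_le_of_ge (le_trans ?_ (mul_le_mul hB hR (by norm_num) (by linarith)))
      norm_num
    · linarith [pi_gt_d6]
  have hinv : 1 / (B ^ 3 * √(r + A * √r)) ≤ 1 / (1.502 ^ 3 * 3.2501) := by gcongr
  norm_num at hmain hexp hinv ⊢
  linarith

theorem monotoneOn_bracket {A B : ℝ} (hA : 0 < A) (hB : 0 < B) :
    MonotoneOn (fun r : ℝ => A * A / (√(1 + A / √r) + 1) -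
      4 * (exp (-(B * √(r + A * √r))) / π + 1 / (B ^ 3 * √(r + A * √r)))) (Set.Ici 1) := by
  intro r hr t _ hrt
  have hr0 : 0 < r := one_pos.trans_le hr
  have hq : 0 < √r := sqrt_pos.2 hr0
  dsimp only
  gcongr

/-- Let `B₀` be the unique maximum point on `(0,∞)` of `B ↦ B · arctan(π/B²)` and
`A₀ = (2B₀/π) arctan(π/B₀²)`. With `Θ = A₀`, for every real `r ≥ 8`,
`Θ A₀/(√(1 + Θ/√r) + 1) - 4(e^{-B₀√(r+Θ√r)}/π + 1/(B₀³√(r+Θ√r))) ≥ 0.009 > 0`;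
moreover this expression is monotonically increasing in `r` for `r ≥ 1`. -/
theorem large_gaps_bracket_bound (B₀ A₀ : ℝ) (hB₀pos : 0 < B₀)
    (hB₀max : ∀ B : ℝ, 0 < B →
      B * Real.arctan (Real.pi / B ^ 2) ≤ B₀ * Real.arctan (Real.pi / B₀ ^ 2))
    (hB₀uniq : ∀ B : ℝ, 0 < B →
      B * Real.arctan (Real.pi / B ^ 2) = B₀ * Real.arctan (Real.pi / B₀ ^ 2) → B = B₀)
    (hA₀ : A₀ = 2 * B₀ / Real.pi * Real.arctan (Real.pi / B₀ ^ 2))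
    (Θ : ℝ) (hΘ : Θ = A₀) :
    (∀ r : ℝ, 8 ≤ r →
      0.009 ≤ Θ * A₀ / (Real.sqrt (1 + Θ / Real.sqrt r) + 1) -
        4 * (Real.exp (-(B₀ * Real.sqrt (r + Θ * Real.sqrt r))) / Real.pi +
          1 / (B₀ ^ 3 * Real.sqrt (r + Θ * Real.sqrt r)))) ∧
    (∀ r : ℝ, 8 ≤ r →
      0 < Θ * A₀ / (Real.sqrt (1 + Θ / Real.sqrt r) + 1) -
        4 * (Real.exp (-(B₀ * Real.sqrt (r + Θ * Real.sqrt r))) / Real.pi +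
          1 / (B₀ ^ 3 * Real.sqrt (r + Θ * Real.sqrt r)))) ∧
    MonotoneOn (fun r : ℝ =>
      Θ * A₀ / (Real.sqrt (1 + Θ / Real.sqrt r) + 1) -
        4 * (Real.exp (-(B₀ * Real.sqrt (r + Θ * Real.sqrt r))) / Real.pi +
          1 / (B₀ ^ 3 * Real.sqrt (r + Θ * Real.sqrt r)))) (Set.Ici 1) := by
  have hB := le_argmax_mul_arctan_pi_div_sq hB₀pos hB₀max
  have hA : 0.9064 ≤ A₀ := hA₀ ▸ le_max_mul_arctan_pi_div_sq hB₀max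
  subst hΘ
  exact ⟨fun r hr => bracket_lower_bound hA hB hr,
    fun r hr => lt_of_lt_of_le (by norm_num) (bracket_lower_bound hA hB hr),
    monotoneOn_bracket (lt_of_lt_of_le (by norm_num) hA) hB₀pos⟩
end
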